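/- For every nondeterministic parity automaton A over a finite alphabet Σ there exists a deterministic Rabin automaton D over Σ recognizing the same ω-language, i.e., for every infinite word w : ℕ → Σ, A has an accepting run on w if and only if the unique run of D on w satisfies the Rabin acceptance condition. -/

import Mathlib

open Filter

/-- A nondeterministic parity automaton over alphabet `A`. -/
structure NPA (A : Type) where
  Q : Type
  [fin : Fintype Q]
  Δ : Q → A → Set Q
  qI : Q
  Ω : Q → ℕ

attribute [instance] NPA.fin

/-- A run of a nondeterministic parity automaton on an infinite word. -/
def NPA.IsRun {A : Type} (P : NPA A) (w : ℕ → A) (ρ : ℕ → P.Q) : Prop :=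
  ρ 0 = P.qI ∧ ∀ i, ρ (i + 1) ∈ P.Δ (ρ i) (w i)

/-- A run is accepting if the least priority occurring infinitely often is even. -/
def NPA.AcceptingRun {A : Type} (P : NPA A) (w : ℕ → A) (ρ : ℕ → P.Q) : Prop :=
  P.IsRun w ρ ∧
    ∃ k : ℕ, IsLeast {k | ∃ᶠ i in atTop, P.Ω (ρ i) = k} k ∧ Even k

/-- Acceptance for a nondeterministic parity automaton. -/
def NPA.Accepts {A : Type} (P : NPA A) (w : ℕ → A) : Prop :=
  ∃ ρ : ℕ → P.Q, P.AcceptingRun w ρ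

/-- A deterministic Rabin automaton over alphabet `A`. -/
structure DRA (A : Type) where
  Q : Type
  [fin : Fintype Q]
  δ : Q → A → Q
  qI : Q
  R : Finset (Set Q × Set Q)

attribute [instance] DRA.fin

/-- The unique run of a deterministic Rabin automaton on an infinite word. -/
def DRA.run {A : Type} (D : DRA A) (w : ℕ → A) : ℕ → D.Q
  | 0 => D.qI
  | i + 1 => D.δ (D.run w i) (w i)

/-- Rabin acceptance: for some pair `(E, G)` in the condition, the run visits `G`
infinitely often and `E` only finitely often. -/
def DRA.Accepts {A : Type} (D : DRA A) (w : ℕ → A) : Prop :=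
  ∃ p ∈ D.R, (∃ᶠ i in atTop, D.run w i ∈ p.2) ∧ (∀ᶠ i in atTop, D.run w i ∉ p.1)

/-- The state at time `j` of a deterministic transition system started in `s` at time `n`. -/
def traceFrom {A S : Type} (δ : S → A → S) (s : S) (w : ℕ → A) (n : ℕ) : ℕ → S
  | 0 => s
  | j + 1 => if j < n then s else δ (traceFrom δ s w n j) (w j)

lemma traceFrom_of_le {A S : Type} (δ : S → A → S) (s : S) (w : ℕ → A) {n j : ℕ} (h : j ≤ n) :
    traceFrom δ s w n j = s := by
  cases j with
  | zero => rfl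
  | succ j => exact if_pos h

lemma traceFrom_succ {A S : Type} (δ : S → A → S) (s : S) (w : ℕ → A) {n j : ℕ} (h : n ≤ j) :
    traceFrom δ s w n (j + 1) = δ (traceFrom δ s w n j) (w j) :=
  if_neg h.not_gt

lemma traceFrom_eq_of_eq {A S : Type} (δ : S → A → S) (s s' : S) (w : ℕ → A) {n n' k j : ℕ}
    (hn : n ≤ k) (hn' : n' ≤ k) (h : traceFrom δ s w n k = traceFrom δ s' w n' k) (hkj : k ≤ j) :
    traceFrom δ s w n j = traceFrom δ s' w n' j := by
  induction j, hkj using Nat.le_induction with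
  | base => exact h
  | succ j hj ih => rw [traceFrom_succ _ _ _ (hn.trans hj), traceFrom_succ _ _ _ (hn'.trans hj), ih]

section Slots

open Classical in
/-- Advance every slot by one letter, emptying those that agree with a smaller slot. -/
noncomputable def survivors {A S : Type} {N : ℕ} (δ : S → A → S) (f : Fin N → Option S) (a : A) :
    Fin N → Option S := fun i =>
  if ∃ j < i, (f j).map (δ · a) = (f i).map (δ · a) then none else (f i).map (δ · a)

lemma survivors_eq_some {A S : Type} {N : ℕ} {δ : S → A → S} {f : Fin N → Option S} {a : A}
    {i : Fin N} {x : S} (h : survivors δ f a i = some x) : ∃ y, f i = some y ∧ x = δ y a := by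
  unfold survivors at h
  split_ifs at h
  obtain ⟨y, hy, rfl⟩ := Option.map_eq_some_iff.1 h
  exact ⟨y, hy, rfl⟩

lemma exists_survivor {A S : Type} {N : ℕ} (δ : S → A → S) (f : Fin N → Option S) (a : A)
    {i : Fin N} {x : S} (h : f i = some x) : ∃ j ≤ i, survivors δ f a j = some (δ x a) := by
  have hne : ∃ j, (f j).map (δ · a) = some (δ x a) := ⟨i, by simp [h]⟩
  obtain ⟨j, hj, hmin⟩ := WellFounded.has_min (wellFounded_lt (α := Fin N))
    {j | (f j).map (δ · a) = some (δ x a)} hne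
  refine ⟨j, not_lt.1 (hmin i (by simp [h])), ?_⟩
  have : ¬ ∃ k < j, (f k).map (δ · a) = (f j).map (δ · a) := by
    rintro ⟨k, hk, hkj⟩
    exact hmin k (hkj.trans hj) hk
  unfold survivors
  rw [if_neg this, hj]

lemma survivors_inj {A S : Type} {N : ℕ} {δ : S → A → S} {f : Fin N → Option S} {a : A}
    {i j : Fin N} {x : S} (hi : survivors δ f a i = some x) (hj : survivors δ f a j = some x) :
    i = j := by
  unfold survivors at hi hj
  split_ifs at hi hj with h1 h2
  rcases lt_trichotomy i j with h | h | h
  · exact absurd ⟨i, h, hi.trans hj.symm⟩ h2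
  · exact h
  · exact absurd ⟨j, h, hj.trans hi.symm⟩ h1

lemma exists_survivors_eq_none {A S : Type} [Finite S] (δ : S → A → S)
    (f : Fin (Nat.card S + 1) → Option S) (a : A) : ∃ i, survivors δ f a i = none := by
  by_contra! h
  choose g hg using fun i => Option.ne_none_iff_exists'.1 (h i)
  have hinj : Function.Injective g := fun i j hij =>
    survivors_inj (hg i) (by rw [hij]; exact hg j)
  have := Nat.card_le_card_of_injective g hinj
  simp at this

/-- The deterministic automaton that starts a fresh copy of `δ` after every letter and keeps the
copies in slots, together with the set of slots that survived the last step. -/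
noncomputable def slotDRA {A T S ι : Type} [Finite T] [Finite S] [Finite ι] (δT : T → A → T)
    (t₀ : T) (init : T → S) (δ : S → A → S) (F : ι → Set S) : DRA A where
  Q := T × (Fin (Nat.card S + 1) → Option S) × Set (Fin (Nat.card S + 1))
  fin := Fintype.ofFinite _
  δ q a := (δT q.1 a,
    Function.update (survivors δ q.2.1 a) (exists_survivors_eq_none δ q.2.1 a).choose
      (some (init (δT q.1 a))),
    {i | survivors δ q.2.1 a i ≠ none})
  qI := (t₀, fun _ => none, ∅)
  R := (Set.toFinite (Set.range fun p : Fin (Nat.card S + 1) × ι =>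
    ({q | p.1 ∉ q.2.2}, {q | ∃ x ∈ F p.2, q.2.1 p.1 = some x}))).toFinset

variable {A T S ι : Type} [Finite T] [Finite S] [Finite ι] (δT : T → A → T)
    (t₀ : T) (init : T → S) (δ : S → A → S) (F : ι → Set S) (w : ℕ → A)

lemma slotDRA_run_fst (j : ℕ) :
    ((slotDRA δT t₀ init δ F).run w j).1 = traceFrom δT t₀ w 0 j := by
  induction j with
  | zero => rfl
  | succ j ih => rw [traceFrom_succ _ _ _ (Nat.zero_le j), ← ih]; rfl

lemma slotDRA_mem_stable (i : Fin (Nat.card S + 1)) (j : ℕ) :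
    i ∈ ((slotDRA δT t₀ init δ F).run w (j + 1)).2.2 ↔
      survivors δ ((slotDRA δT t₀ init δ F).run w j).2.1 (w j) i ≠ none := Iff.rfl

lemma slotDRA_slot_of_survives {i : Fin (Nat.card S + 1)} {j : ℕ} {x : S}
    (h : survivors δ ((slotDRA δT t₀ init δ F).run w j).2.1 (w j) i = some x) :
    ((slotDRA δT t₀ init δ F).run w (j + 1)).2.1 i = some x := by
  have hs := (exists_survivors_eq_none δ ((slotDRA δT t₀ init δ F).run w j).2.1 (w j)).choose_spec
  refine (Function.update_of_ne ?_ _ _).trans h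
  rintro rfl
  rw [hs] at h
  cases h

lemma slotDRA_exists_new_slot (j : ℕ) :
    ∃ i, ((slotDRA δT t₀ init δ F).run w (j + 1)).2.1 i =
      some (init (traceFrom δT t₀ w 0 (j + 1))) := by
  rw [← slotDRA_run_fst δT t₀ init δ F w]
  exact ⟨_, Function.update_self _ _ _⟩

lemma slotDRA_slot_eq_trace (j : ℕ) {i : Fin (Nat.card S + 1)} {x : S}
    (h : ((slotDRA δT t₀ init δ F).run w j).2.1 i = some x) :
    ∃ n, 0 < n ∧ n ≤ j ∧ x = traceFrom δ (init (traceFrom δT t₀ w 0 n)) w n j := by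
  induction j generalizing i x with
  | zero => cases h
  | succ j ih =>
    have hdef : ((slotDRA δT t₀ init δ F).run w (j + 1)).2.1 = Function.update
      (survivors δ ((slotDRA δT t₀ init δ F).run w j).2.1 (w j))
      (exists_survivors_eq_none δ ((slotDRA δT t₀ init δ F).run w j).2.1 (w j)).choose
      (some (init ((slotDRA δT t₀ init δ F).run w (j + 1)).1)) := rfl
    rw [hdef, Function.update_apply, slotDRA_run_fst] at h
    split_ifs at h with hi
    · refine ⟨j + 1, j.succ_pos, le_rfl, ?_⟩
      rw [traceFrom_of_le _ _ _ le_rfl]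
      exact (Option.some.inj h).symm
    · obtain ⟨y, hy, rfl⟩ := survivors_eq_some h
      obtain ⟨n, hn, hnj, rfl⟩ := ih hy
      exact ⟨n, hn, hnj.trans j.le_succ, (traceFrom_succ _ _ _ hnj).symm⟩

lemma slotDRA_accepts_iff :
    (slotDRA δT t₀ init δ F).Accepts w ↔ ∃ n, 0 < n ∧ ∃ k, ∃ᶠ j in atTop,
      traceFrom δ (init (traceFrom δT t₀ w 0 n)) w n j ∈ F k := by
  set D := slotDRA δT t₀ init δ F
  constructor
  · rintro ⟨p, hp, hG, hE⟩
    obtain ⟨⟨i, k⟩, rfl⟩ := (Set.Finite.mem_toFinset _).1 hp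
    obtain ⟨J, hJ⟩ := eventually_atTop.1 hE
    have hst : ∀ j ≥ J, i ∈ (D.run w j).2.2 := fun j hj => not_not.1 (hJ j hj)
    have hsurv : ∀ j ≥ J, ∃ x, survivors δ (D.run w j).2.1 (w j) i = some x := fun j hj =>
      Option.ne_none_iff_exists'.1
        ((slotDRA_mem_stable δT t₀ init δ F w i j).1 (hst (j + 1) (by omega)))
    obtain ⟨x, hx⟩ := hsurv J le_rfl
    obtain ⟨y, hy, -⟩ := survivors_eq_some hx
    obtain ⟨n, hn, hnJ, rfl⟩ := slotDRA_slot_eq_trace δT t₀ init δ F w J hy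
    have key : ∀ j ≥ J, (D.run w j).2.1 i =
        some (traceFrom δ (init (traceFrom δT t₀ w 0 n)) w n j) := by
      intro j hj
      induction j, hj using Nat.le_induction with
      | base => exact hy
      | succ j hj ih =>
        obtain ⟨x, hx⟩ := hsurv j hj
        obtain ⟨y, hy, rfl⟩ := survivors_eq_some hx
        rw [ih] at hy
        cases hy
        rw [traceFrom_succ _ _ _ (hnJ.trans hj)]
        exact slotDRA_slot_of_survives δT t₀ init δ F w hx
    refine ⟨n, hn, k, (hG.and_eventually (eventually_ge_atTop J)).mono ?_⟩
    rintro j ⟨⟨x, hxF, hx⟩, hj⟩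
    have hxj := (key j hj).symm.trans hx
    cases hxj
    exact hxF
  · rintro ⟨n, hn, k, hF⟩
    obtain ⟨i₀, hi₀⟩ : ∃ i, (D.run w n).2.1 i =
        some (traceFrom δ (init (traceFrom δT t₀ w 0 n)) w n n) := by
      rw [traceFrom_of_le _ _ _ le_rfl]
      obtain ⟨n, rfl⟩ := Nat.exists_eq_succ_of_ne_zero hn.ne'
      exact slotDRA_exists_new_slot δT t₀ init δ F w n
    obtain ⟨i, ⟨J, hnJ, hJ⟩, hmin⟩ := WellFounded.has_min
      (wellFounded_lt (α := Fin (Nat.card S + 1)))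
      {i | ∃ j ≥ n, (D.run w j).2.1 i =
        some (traceFrom δ (init (traceFrom δT t₀ w 0 n)) w n j)} ⟨i₀, n, le_rfl, hi₀⟩
    have hnext : ∀ j ≥ n, (D.run w j).2.1 i =
          some (traceFrom δ (init (traceFrom δT t₀ w 0 n)) w n j) →
        survivors δ (D.run w j).2.1 (w j) i =
          some (traceFrom δ (init (traceFrom δT t₀ w 0 n)) w n (j + 1)) := by
      intro j hj h
      obtain ⟨i', hi', hs⟩ := exists_survivor δ (D.run w j).2.1 (w j) h
      rw [← traceFrom_succ δ _ w hj] at hs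
      have := hmin i' ⟨j + 1, by omega, slotDRA_slot_of_survives δT t₀ init δ F w hs⟩
      rwa [le_antisymm hi' (not_lt.1 this)] at hs
    have key : ∀ j ≥ J, (D.run w j).2.1 i =
        some (traceFrom δ (init (traceFrom δT t₀ w 0 n)) w n j) := by
      intro j hj
      induction j, hj using Nat.le_induction with
      | base => exact hJ
      | succ j hj ih =>
        exact slotDRA_slot_of_survives δT t₀ init δ F w (hnext j (hnJ.trans hj) ih)
    refine ⟨_, (Set.Finite.mem_toFinset _).2 ⟨(i, k), rfl⟩, ?_, ?_⟩
    · refine (hF.and_eventually (eventually_ge_atTop J)).mono ?_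
      rintro j ⟨hj, hJj⟩
      exact ⟨_, hj, key j hJj⟩
    · refine eventually_atTop.2 ⟨J + 1, fun j hj => not_not.2 ?_⟩
      obtain ⟨j, rfl⟩ : ∃ j', j = j' + 1 := ⟨j - 1, by omega⟩
      refine (slotDRA_mem_stable δT t₀ init δ F w i j).2 ?_
      rw [hnext j (by omega) (key j (by omega))]
      simp

end Slots

section Merging

/-- `n` is a position such that for infinitely many `m`, the copy of `δ` started at `n` is in
state `e` at time `m` and later merges with the copy started at `m`. -/
def IsMergingPoint {A M : Type} (δ : M → A → M) (s₀ : M) (w : ℕ → A) (e : M) (n : ℕ) : Prop :=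
  ∃ᶠ m in atTop, traceFrom δ s₀ w n m = e ∧
    ∃ k > m, traceFrom δ s₀ w n k = traceFrom δ s₀ w m k

lemma exists_isMergingPoint {A M : Type} [Finite M] (δ : M → A → M) (s₀ : M) (w : ℕ → A) :
    ∃ e n, 0 < n ∧ IsMergingPoint δ s₀ w e n := by
  have hlim : ∀ g : ℕ → M, ∃ e, ∀ᶠ m in (hyperfilter ℕ : Filter ℕ), g m = e := by
    intro g
    exact Ultrafilter.eventually_exists_iff.1 (Eventually.of_forall fun m => ⟨_, rfl⟩)
  have hle : (hyperfilter ℕ : Filter ℕ) ≤ atTop := by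
    rw [← Nat.cofinite_eq_atTop]; exact hyperfilter_le_cofinite
  choose f hf using fun n => hlim (traceFrom δ s₀ w n)
  obtain ⟨e, he⟩ := hlim f
  obtain ⟨n, hn, hn0⟩ := (he.and (hle (eventually_gt_atTop 0))).exists
  refine ⟨e, n, hn0, Frequently.filter_mono ?_ hle⟩
  refine Eventually.frequently ?_
  filter_upwards [hf n, he] with m hm hem
  refine ⟨hm.trans hn, ?_⟩
  obtain ⟨k, h1, h2, h3⟩ :=
    ((hf n).and ((hf m).and (hle (eventually_gt_atTop m)))).exists
  exact ⟨k, h3, by rw [h1, h2, hn, hem]⟩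

lemma IsMergingPoint.exists_factorization {A M : Type} {δ : M → A → M} {s₀ : M} {w : ℕ → A}
    {e : M} {n : ℕ} (h : IsMergingPoint δ s₀ w e n) (hn : 0 < n) :
    ∃ m : ℕ → ℕ, StrictMono m ∧ m 0 = 0 ∧ m 1 = n ∧
      ∀ i, traceFrom δ s₀ w (m (i + 1)) (m (i + 2)) = e := by
  have hnext : ∀ a : {a // n ≤ a ∧ ∃ k > a, traceFrom δ s₀ w n k = traceFrom δ s₀ w a k},
      ∃ b : {a // n ≤ a ∧ ∃ k > a, traceFrom δ s₀ w n k = traceFrom δ s₀ w a k},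
        a.1 < b.1 ∧ traceFrom δ s₀ w a.1 b.1 = e := by
    rintro ⟨a, hna, k, hk, hnk⟩
    obtain ⟨b, ⟨hb, hb'⟩, hkb⟩ := (h.and_eventually (eventually_gt_atTop k)).exists
    refine ⟨⟨b, by omega, hb'⟩, by simp only; omega, ?_⟩
    rw [← hb]
    exact (traceFrom_eq_of_eq δ s₀ s₀ w (by omega) hk.le hnk hkb.le).symm
  choose g hg hge using hnext
  let u : ℕ → {a // n ≤ a ∧ ∃ k > a, traceFrom δ s₀ w n k = traceFrom δ s₀ w a k} :=
    fun i => g^[i] ⟨n, le_rfl, n + 1, n.lt_succ_self, rfl⟩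
  have hu : ∀ i, u (i + 1) = g (u i) := fun i => Function.iterate_succ_apply' _ _ _
  refine ⟨fun i => Nat.casesOn i 0 fun i => (u i).1, strictMono_nat_of_lt_succ ?_, rfl, rfl, ?_⟩
  · rintro (_ | i)
    · exact hn
    · change (u i).1 < (u (i + 1)).1
      rw [hu]
      exact hg _
  · intro i
    change traceFrom δ s₀ w (u i).1 (u (i + 1)).1 = e
    rw [hu]
    exact hge _

/-- The deterministic Büchi automaton detecting merging points. A state consists of the state of
`δ`, for each `e` the states of the pending copies started when the state was `e`, and the set
of those `e` for which a pending copy has just merged. -/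
def mergeStep {A M : Type} (δ : M → A → M) (s₀ : M) (q : M × (M → Set M) × Set M) (a : A) :
    M × (M → Set M) × Set M :=
  (δ q.1 a,
    fun e => {y | ((∃ z ∈ q.2.1 e, δ z a = y) ∧ ¬ ∃ z ∈ q.2.1 e, δ z a = δ q.1 a) ∨
      (y = s₀ ∧ δ q.1 a = e)},
    {e | ∃ z ∈ q.2.1 e, δ z a = δ q.1 a})

variable {A M : Type} (δ : M → A → M) (s₀ : M) (w : ℕ → A) (n : ℕ)

/-- The run of the automaton `mergeStep` started at position `n`. -/
def mergeTrace : ℕ → M × (M → Set M) × Set M :=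
  traceFrom (mergeStep δ s₀) (s₀, fun _ => ∅, ∅) w n

variable {n}

lemma mergeTrace_succ {j : ℕ} (hj : n ≤ j) :
    mergeTrace δ s₀ w n (j + 1) = mergeStep δ s₀ (mergeTrace δ s₀ w n j) (w j) :=
  traceFrom_succ _ _ _ hj

lemma mergeTrace_fst {j : ℕ} (hj : n ≤ j) :
    (mergeTrace δ s₀ w n j).1 = traceFrom δ s₀ w n j := by
  induction j, hj using Nat.le_induction with
  | base => rw [mergeTrace, traceFrom_of_le _ _ _ le_rfl, traceFrom_of_le _ _ _ le_rfl]
  | succ j hj ih => rw [mergeTrace_succ _ _ _ hj, traceFrom_succ _ _ _ hj, ← ih]; rfl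

lemma mem_mergeTrace_flag {j : ℕ} (hj : n ≤ j) {e : M} :
    e ∈ (mergeTrace δ s₀ w n (j + 1)).2.2 ↔
      ∃ z ∈ (mergeTrace δ s₀ w n j).2.1 e, δ z (w j) = traceFrom δ s₀ w n (j + 1) := by
  rw [traceFrom_succ _ _ _ hj, ← mergeTrace_fst _ _ _ hj, mergeTrace_succ _ _ _ hj]
  rfl

lemma mem_mergeTrace_pending {j : ℕ} (hj : n ≤ j) {e y : M} :
    y ∈ (mergeTrace δ s₀ w n (j + 1)).2.1 e ↔
      ((∃ z ∈ (mergeTrace δ s₀ w n j).2.1 e, δ z (w j) = y) ∧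
        e ∉ (mergeTrace δ s₀ w n (j + 1)).2.2) ∨
      (y = s₀ ∧ traceFrom δ s₀ w n (j + 1) = e) := by
  rw [traceFrom_succ _ _ _ hj, ← mergeTrace_fst _ _ _ hj, mergeTrace_succ _ _ _ hj]
  rfl

lemma mergeTrace_pending_of_flag {j₀ : ℕ} (hj₀ : n ≤ j₀) {e : M}
    (h₀ : e ∈ (mergeTrace δ s₀ w n (j₀ + 1)).2.2) {j : ℕ} (hj : j₀ + 1 ≤ j) {y : M}
    (hy : y ∈ (mergeTrace δ s₀ w n j).2.1 e) :
    ∃ m, j₀ < m ∧ m ≤ j ∧ traceFrom δ s₀ w n m = e ∧ traceFrom δ s₀ w m j = y := by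
  induction j, hj using Nat.le_induction generalizing y with
  | base =>
    rcases (mem_mergeTrace_pending _ _ _ hj₀).1 hy with h | ⟨rfl, h⟩
    · exact absurd h₀ h.2
    · exact ⟨j₀ + 1, by omega, le_rfl, h, traceFrom_of_le _ _ _ le_rfl⟩
  | succ j hj ih =>
    rcases (mem_mergeTrace_pending _ _ _ (by omega)).1 hy with ⟨⟨z, hz, rfl⟩, -⟩ | ⟨rfl, h⟩
    · obtain ⟨m, h1, h2, h3, rfl⟩ := ih hz
      exact ⟨m, h1, by omega, h3, traceFrom_succ _ _ _ h2⟩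
    · exact ⟨j + 1, by omega, le_rfl, h, traceFrom_of_le _ _ _ le_rfl⟩

lemma frequently_flag_iff_isMergingPoint {e : M} :
    (∃ᶠ j in atTop, e ∈ (mergeTrace δ s₀ w n j).2.2) ↔ IsMergingPoint δ s₀ w e n := by
  constructor
  · intro h
    rw [IsMergingPoint, frequently_atTop]
    intro N
    obtain ⟨j₀, hj₀, h₀⟩ := frequently_atTop.1 h (N + n + 1)
    obtain ⟨j₁, hj₁, h₁⟩ := frequently_atTop.1 h (j₀ + 1)
    obtain ⟨j₀, rfl⟩ : ∃ j, j₀ = j + 1 := ⟨j₀ - 1, by omega⟩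
    obtain ⟨j₁, rfl⟩ : ∃ j, j₁ = j + 1 := ⟨j₁ - 1, by omega⟩
    obtain ⟨z, hz, hz'⟩ := (mem_mergeTrace_flag _ _ _ (by omega)).1 h₁
    obtain ⟨m, hm, hmj, hme, rfl⟩ :=
      mergeTrace_pending_of_flag _ _ _ (by omega) h₀ (by omega) hz
    refine ⟨m, by omega, hme, j₁ + 1, by omega, ?_⟩
    rw [← hz', traceFrom_succ _ _ _ hmj]
  · intro h hno
    obtain ⟨J, hJ⟩ := eventually_atTop.1 hno
    obtain ⟨m, hm, hme, k, hk, hnk⟩ := frequently_atTop.1 h (J + n + 1)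
    have key : ∀ j ≥ m, traceFrom δ s₀ w m j ∈ (mergeTrace δ s₀ w n j).2.1 e := by
      intro j hj
      induction j, hj using Nat.le_induction with
      | base =>
        obtain ⟨m, rfl⟩ : ∃ j, m = j + 1 := ⟨m - 1, by omega⟩
        exact (mem_mergeTrace_pending _ _ _ (by omega)).2
          (Or.inr ⟨traceFrom_of_le _ _ _ le_rfl, hme⟩)
      | succ j hj ih =>
        exact (mem_mergeTrace_pending _ _ _ (by omega)).2
          (Or.inl ⟨⟨_, ih, (traceFrom_succ _ _ _ hj).symm⟩, hJ _ (by omega)⟩)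
    obtain ⟨k, rfl⟩ : ∃ j, k = j + 1 := ⟨k - 1, by omega⟩
    refine hJ (k + 1) (by omega) ((mem_mergeTrace_flag _ _ _ (by omega)).2 ⟨_, key k (by omega), ?_⟩)
    rw [hnk, traceFrom_succ _ _ _ (by omega)]

end Merging

lemma exists_dra_of_mergingPoints {A M : Type} [Finite M] (δ : M → A → M) (s₀ : M)
    (good : M → M → Prop) :
    ∃ D : DRA A, ∀ w, D.Accepts w ↔ ∃ n, 0 < n ∧ ∃ e, IsMergingPoint δ s₀ w e n ∧
      good (traceFrom δ s₀ w 0 n) e := by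
  let step : M × (M × (M → Set M) × Set M) → A → M × (M × (M → Set M) × Set M) :=
    fun q a => (q.1, mergeStep δ s₀ q.2 a)
  have hstep : ∀ (w : ℕ → A) s n j,
      traceFrom step (s, (s₀, fun _ => ∅, ∅)) w n j = (s, mergeTrace δ s₀ w n j) := by
    intro w s n j
    induction j with
    | zero => rfl
    | succ j ih =>
      simp only [mergeTrace, traceFrom] at ih ⊢
      split_ifs
      · rfl
      · rw [ih]
  refine ⟨slotDRA δ s₀ (fun s => (s, (s₀, fun _ => ∅, ∅))) step
    (fun e : M => {q | e ∈ q.2.2.2 ∧ good q.1 e}), fun w => ?_⟩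
  rw [slotDRA_accepts_iff]
  refine exists_congr fun n => and_congr_right fun _ => exists_congr fun e => ?_
  rw [← frequently_flag_iff_isMergingPoint]
  simp only [hstep, Set.mem_ofPred_eq]
  by_cases h : good (traceFrom δ s₀ w 0 n) e <;> simp [h]

section Profiles

variable {A : Type} (P : NPA A)

/-- `ρ` is a path of `P` over the factor of `w` between positions `i` and `j`, and `r` is a state
of least priority on it. -/
def NPA.IsPath (w : ℕ → A) (i j : ℕ) (ρ : ℕ → P.Q) (r : P.Q) : Prop :=
  (∀ t, i ≤ t → t < j → ρ (t + 1) ∈ P.Δ (ρ t) (w t)) ∧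
    (∃ t, i ≤ t ∧ t ≤ j ∧ ρ t = r) ∧ ∀ t, i ≤ t → t ≤ j → P.Ω r ≤ P.Ω (ρ t)

/-- Extend a set of triples (source, target, state of least priority) of paths by one letter. -/
def NPA.profileStep (X : Set (P.Q × P.Q × P.Q)) (a : A) : Set (P.Q × P.Q × P.Q) :=
  {x | ∃ q r, (x.1, q, r) ∈ X ∧ x.2.1 ∈ P.Δ q a ∧
    ((x.2.2 = r ∧ P.Ω r ≤ P.Ω x.2.1) ∨ (x.2.2 = x.2.1 ∧ P.Ω x.2.1 ≤ P.Ω r))}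

/-- The set of triples (source, target, state of least priority) of paths over a factor of `w`. -/
def NPA.profile (w : ℕ → A) (i j : ℕ) : Set (P.Q × P.Q × P.Q) :=
  traceFrom P.profileStep {x | x.1 = x.2.1 ∧ x.2.2 = x.2.1} w i j

variable {P}

lemma NPA.exists_isPath_of_mem_profile {w : ℕ → A} {i j : ℕ} (hij : i ≤ j) {p q r : P.Q}
    (h : (p, q, r) ∈ P.profile w i j) : ∃ ρ, P.IsPath w i j ρ r ∧ ρ i = p ∧ ρ j = q := by
  induction j, hij using Nat.le_induction generalizing q r with
  | base =>
    rw [NPA.profile, traceFrom_of_le _ _ _ le_rfl] at h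
    obtain ⟨h1, h2⟩ := h
    simp only at h1 h2
    subst h1 h2
    exact ⟨fun _ => r, ⟨fun t h1 h2 => by omega, ⟨i, le_rfl, le_rfl, rfl⟩, fun _ _ _ => le_rfl⟩,
      rfl, rfl⟩
  | succ j hj ih =>
    rw [NPA.profile, traceFrom_succ _ _ _ hj] at h
    obtain ⟨q', r', h1, h2, h3⟩ := h
    simp only at h1 h2 h3
    obtain ⟨ρ, ⟨hρ, ⟨t₀, ht₀, ht₀', hr⟩, hmin⟩, hi, hj'⟩ := ih h1
    have hold : ∀ t ≤ j, Function.update ρ (j + 1) q t = ρ t := fun t ht =>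
      Function.update_of_ne (by omega) _ _
    have hnew : Function.update ρ (j + 1) q (j + 1) = q := Function.update_self _ _ _
    refine ⟨Function.update ρ (j + 1) q, ⟨?_, ?_, ?_⟩, by rw [hold i hj, hi], hnew⟩
    · intro t ht htj
      rcases Nat.lt_succ_iff_lt_or_eq.1 htj with h | rfl
      · rw [hold t h.le, hold (t + 1) h]
        exact hρ t ht h
      · rw [hnew, hold t le_rfl, hj']
        exact h2
    · rcases h3 with ⟨rfl, -⟩ | ⟨rfl, -⟩
      · exact ⟨t₀, ht₀, by omega, by rw [hold t₀ ht₀', hr]⟩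
      · exact ⟨j + 1, by omega, le_rfl, hnew⟩
    · intro t ht htj
      have hr' : P.Ω r ≤ P.Ω r' ∧ P.Ω r ≤ P.Ω q := by
        rcases h3 with ⟨rfl, h⟩ | ⟨rfl, h⟩
        · exact ⟨le_rfl, h⟩
        · exact ⟨h, le_rfl⟩
      rcases Nat.le_succ_iff.1 htj with h | rfl
      · rw [hold t h]
        exact hr'.1.trans (hmin t ht h)
      · rw [hnew]
        exact hr'.2

lemma NPA.exists_mem_profile {w : ℕ → A} {i j : ℕ} (hij : i ≤ j) {ρ : ℕ → P.Q}
    (h : ∀ t, i ≤ t → t < j → ρ (t + 1) ∈ P.Δ (ρ t) (w t)) :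
    ∃ r, (ρ i, ρ j, r) ∈ P.profile w i j ∧ P.IsPath w i j ρ r := by
  induction j, hij using Nat.le_induction with
  | base =>
    refine ⟨ρ i, ?_, h, ⟨i, le_rfl, le_rfl, rfl⟩, fun t h1 h2 => by rw [le_antisymm h1 h2]⟩
    rw [NPA.profile, traceFrom_of_le _ _ _ le_rfl]
    exact ⟨rfl, rfl⟩
  | succ j hj ih =>
    obtain ⟨r, hr, -, ⟨t₀, ht₀, ht₀', htr⟩, hmin⟩ := ih fun t h1 h2 => h t h1 (by omega)
    rw [NPA.profile, traceFrom_succ _ _ _ hj]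
    rcases le_total (P.Ω r) (P.Ω (ρ (j + 1))) with hle | hle
    · refine ⟨r, ⟨_, r, hr, h j hj (by omega), Or.inl ⟨rfl, hle⟩⟩, h,
        ⟨t₀, ht₀, by omega, htr⟩, fun t h1 h2 => ?_⟩
      rcases Nat.le_succ_iff.1 h2 with h2 | rfl
      exacts [hmin t h1 h2, hle]
    · refine ⟨ρ (j + 1), ⟨_, r, hr, h j hj (by omega), Or.inr ⟨rfl, hle⟩⟩, h,
        ⟨j + 1, by omega, le_rfl, rfl⟩, fun t h1 h2 => ?_⟩
      rcases Nat.le_succ_iff.1 h2 with h2 | rfl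
      exacts [hle.trans (hmin t h1 h2), le_rfl]

end Profiles

lemma isLeast_frequently_eq_iff (a : ℕ → ℕ) (k : ℕ) :
    IsLeast {k | ∃ᶠ t in atTop, a t = k} k ↔
      (∃ᶠ t in atTop, a t = k) ∧ ∀ᶠ t in atTop, k ≤ a t := by
  refine and_congr_right fun _ => ⟨fun h => ?_, fun h k' hk' => ?_⟩
  · have : ∀ᶠ t in atTop, ∀ k' ∈ Set.Iio k, a t ≠ k' :=
      (eventually_all_finite (Set.finite_Iio k)).2 fun k' hk' =>
        not_frequently.1 fun hf => (h hf).not_gt hk'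
    exact this.mono fun t ht => not_lt.1 fun hlt => ht _ hlt rfl
  · obtain ⟨t, rfl, h⟩ := (Frequently.and_eventually hk' h).exists
    exact h

lemma exists_segment {m : ℕ → ℕ} (hm : StrictMono m) (h0 : m 0 = 0) (t : ℕ) :
    ∃ i, m i ≤ t ∧ t < m (i + 1) := by
  have hex : ∃ i, t < m (i + 1) := ⟨t, hm.le_apply.trans_lt' (Nat.lt_succ_self t)⟩
  classical
  refine ⟨Nat.find hex, ?_, Nat.find_spec hex⟩
  rcases h : Nat.find hex with _ | i
  · omega
  · exact not_lt.1 (Nat.find_min hex (by omega))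

/-- The least value occurring infinitely often is determined by the minima on the segments of a
factorization. -/
lemma isLeast_frequently_iff_segments {m : ℕ → ℕ} (hm : StrictMono m) (h0 : m 0 = 0) {a b : ℕ → ℕ}
    (hex : ∀ i, ∃ t, m i ≤ t ∧ t ≤ m (i + 1) ∧ a t = b i)
    (hle : ∀ i t, m i ≤ t → t ≤ m (i + 1) → b i ≤ a t) (k : ℕ) :
    IsLeast {k | ∃ᶠ t in atTop, a t = k} k ↔ IsLeast {k | ∃ᶠ i in atTop, b i = k} k := by
  have hev : (∀ᶠ t in atTop, k ≤ a t) ↔ ∀ᶠ i in atTop, k ≤ b i := by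
    simp only [eventually_atTop]
    constructor
    · rintro ⟨N, hN⟩
      refine ⟨N, fun i hi => ?_⟩
      obtain ⟨t, h1, -, h3⟩ := hex i
      rw [← h3]
      exact hN t (hi.trans (hm.le_apply.trans h1))
    · rintro ⟨N, hN⟩
      refine ⟨m N, fun t ht => ?_⟩
      obtain ⟨i, h1, h2⟩ := exists_segment hm h0 t
      have : N < i + 1 := hm.lt_iff_lt.1 (ht.trans_lt h2)
      exact (hN i (by omega)).trans (hle i t h1 h2.le)
  rw [isLeast_frequently_eq_iff, isLeast_frequently_eq_iff, hev]
  refine and_congr_left fun hk => ?_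
  simp only [frequently_atTop]
  constructor
  · intro h N
    obtain ⟨K, hK⟩ := eventually_atTop.1 hk
    obtain ⟨t, ht, rfl⟩ := h (m (N + K))
    obtain ⟨i, h1, h2⟩ := exists_segment hm h0 t
    have : N + K < i + 1 := hm.lt_iff_lt.1 (ht.trans_lt h2)
    exact ⟨i, by omega, le_antisymm (hle i t h1 h2.le) (hK i (by omega))⟩
  · intro h N
    obtain ⟨i, hi, rfl⟩ := h N
    obtain ⟨t, h1, -, h3⟩ := hex i
    exact ⟨t, hi.trans (hm.le_apply.trans h1), h3⟩

lemma exists_glued_path {S : Type} {m : ℕ → ℕ} (hm : StrictMono m) (h0 : m 0 = 0)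
    (ρ : ℕ → ℕ → S) (hρ : ∀ i, ρ i (m (i + 1)) = ρ (i + 1) (m (i + 1))) :
    ∃ σ : ℕ → S, ∀ i t, m i ≤ t → t ≤ m (i + 1) → σ t = ρ i t := by
  choose idx hidx hidx' using exists_segment hm h0
  have hlt : ∀ i t, m i ≤ t → t < m (i + 1) → idx t = i := by
    intro i t h1 h2
    have h3 : idx t < i + 1 := hm.lt_iff_lt.1 ((hidx t).trans_lt h2)
    have h4 : i < idx t + 1 := hm.lt_iff_lt.1 (h1.trans_lt (hidx' t))
    omega
  refine ⟨fun t => ρ (idx t) t, fun i t h1 h2 => ?_⟩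
  rcases h2.lt_or_eq with h2 | rfl
  · simp only [hlt i t h1 h2]
  · simp only [hlt (i + 1) _ le_rfl (hm (Nat.lt_succ_self _)), hρ]

lemma NPA.accepts_of_profile_eq {A : Type} {P : NPA A} {w w' : ℕ → A} {m m' : ℕ → ℕ}
    (hm : StrictMono m) (h0 : m 0 = 0) (hm' : StrictMono m') (h0' : m' 0 = 0)
    (h : ∀ i, P.profile w (m i) (m (i + 1)) = P.profile w' (m' i) (m' (i + 1)))
    (hacc : P.Accepts w') : P.Accepts w := by
  obtain ⟨ρ', ⟨hI, hΔ⟩, k, hk, hev⟩ := hacc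
  choose r hr hpath' using fun i =>
    P.exists_mem_profile (hm' (Nat.lt_succ_self i)).le fun t _ _ => hΔ t
  simp only [← h] at hr
  choose ρ hpath hstart hend using fun i =>
    P.exists_isPath_of_mem_profile (hm (Nat.lt_succ_self i)).le (hr i)
  obtain ⟨σ, hσ⟩ := exists_glued_path hm h0 ρ fun i => (hend i).trans (hstart (i + 1)).symm
  refine ⟨σ, ⟨?_, fun t => ?_⟩, k, ?_, hev⟩
  · have := hσ 0 (m 0) le_rfl (hm Nat.zero_lt_one).le
    rwa [hstart, h0, h0', hI] at this
  · obtain ⟨i, h1, h2⟩ := exists_segment hm h0 t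
    rw [hσ i t h1 h2.le, hσ i (t + 1) (by omega) h2]
    exact (hpath i).1 t h1 h2
  · rw [isLeast_frequently_iff_segments hm' h0' (b := fun i => P.Ω (r i))
      (fun i => (hpath' i).2.1.imp fun t ht => ⟨ht.1, ht.2.1, by rw [ht.2.2]⟩)
      (fun i => (hpath' i).2.2)] at hk
    rw [isLeast_frequently_iff_segments hm h0 (b := fun i => P.Ω (r i))
      (fun i => (hpath i).2.1.imp fun t ht =>
        ⟨ht.1, ht.2.1, by rw [hσ i t ht.1 ht.2.1, ht.2.2]⟩)
      (fun i t h1 h2 => by rw [hσ i t h1 h2]; exact (hpath i).2.2 t h1 h2)]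
    exact hk

/-- Every nondeterministic parity automaton is equivalent to a deterministic
Rabin automaton. -/
theorem npa_to_dra (A : Type) [Fintype A] [Nonempty A] (P : NPA A) :
    ∃ D : DRA A, ∀ w : ℕ → A, P.Accepts w ↔ D.Accepts w := by
  set s₀ : Set (P.Q × P.Q × P.Q) := {x | x.1 = x.2.1 ∧ x.2.2 = x.2.1}
  obtain ⟨D, hD⟩ := exists_dra_of_mergingPoints P.profileStep s₀ fun s e =>
    ∃ w n, 0 < n ∧ IsMergingPoint P.profileStep s₀ w e n ∧
      traceFrom P.profileStep s₀ w 0 n = s ∧ P.Accepts w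
  refine ⟨D, fun w => ?_⟩
  rw [hD]
  constructor
  · intro hacc
    obtain ⟨e, n, hn, hmerge⟩ := exists_isMergingPoint P.profileStep s₀ w
    exact ⟨n, hn, e, hmerge, w, n, hn, hmerge, rfl, hacc⟩
  · rintro ⟨n, hn, e, hmerge, w', n', hn', hmerge', hs, hacc⟩
    obtain ⟨m, hm, h0, h1, he⟩ := hmerge.exists_factorization hn
    obtain ⟨m', hm', h0', h1', he'⟩ := hmerge'.exists_factorization hn'
    refine P.accepts_of_profile_eq hm h0 hm' h0' ?_ hacc
    rintro (_ | i)
    · rw [zero_add, h0, h0', h1, h1']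
      exact hs.symm
    · exact (he i).trans (he' i).symm
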